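/- Let α₁, α₂ ∈ ℂ[X₁, X₂] be homogeneous polynomials of degree 3 with no common zero in ℂ² ∖ {(0,0)}. Then there exist an invertible matrix (bᵢⱼ) ∈ GL₂(ℂ), an invertible matrix A ∈ GL₂(ℂ), and constants e, g ∈ ℂ such that, writing α₁′ = b₁₁α₁ + b₁₂α₂ and α₂′ = b₂₁α₁ + b₂₂α₂ and substituting (X₁, X₂) ↦ A·(X₁, X₂), one has α₁′(A(X₁, X₂)) = X₁³ + eX₁²X₂ and α₂′(A(X₁, X₂)) = gX₁X₂² + X₂³. -/

import Mathlib

open MvPolynomial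

/-- The linear substitution `(X₁, X₂) ↦ A·(X₁, X₂)` on `ℂ[X₁, X₂]`
(with `X₁ = X 0, X₂ = X 1`). -/
noncomputable def substA (A : Matrix (Fin 2) (Fin 2) ℂ) :
    MvPolynomial (Fin 2) ℂ →ₐ[ℂ] MvPolynomial (Fin 2) ℂ :=
  aeval fun i => C (A i 0) * X 0 + C (A i 1) * X 1

open Polynomial in
theorem exists_root_quartic (c₀ c₁ c₂ c₃ c₄ : ℂ) (h : c₂ ≠ 0 ∨ c₃ ≠ 0 ∨ c₄ ≠ 0) :
    ∃ t : ℂ, c₀ + c₁ * t + c₂ * t ^ 2 + c₃ * t ^ 3 + c₄ * t ^ 4 = 0 := by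
  set P : ℂ[X] := Polynomial.C c₀ + Polynomial.C c₁ * Polynomial.X
    + Polynomial.C c₂ * Polynomial.X ^ 2 + Polynomial.C c₃ * Polynomial.X ^ 3
    + Polynomial.C c₄ * Polynomial.X ^ 4 with hP
  have hdeg : P.degree ≠ 0 := by
    intro h0
    have hC := Polynomial.eq_C_of_degree_eq_zero h0
    have k2 : P.coeff 2 = 0 := by rw [hC]; simp
    have k3 : P.coeff 3 = 0 := by rw [hC]; simp
    have k4 : P.coeff 4 = 0 := by rw [hC]; simp
    simp [hP, Polynomial.coeff_X_pow] at k2 k3 k4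
    tauto
  obtain ⟨t, ht⟩ := IsAlgClosed.exists_root P hdeg
  exact ⟨t, by simpa [hP] using ht⟩

/-- The binary cubic with the given coefficients, in increasing powers of `X 1`. -/
noncomputable def binaryCubic (a₀ a₁ a₂ a₃ : ℂ) : MvPolynomial (Fin 2) ℂ :=
  C a₀ * X 0 ^ 3 + C a₁ * X 0 ^ 2 * X 1 + C a₂ * X 0 * X 1 ^ 2 + C a₃ * X 1 ^ 3

theorem eval_binaryCubic (a₀ a₁ a₂ a₃ : ℂ) (x : Fin 2 → ℂ) :
    eval x (binaryCubic a₀ a₁ a₂ a₃) =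
      a₀ * x 0 ^ 3 + a₁ * x 0 ^ 2 * x 1 + a₂ * x 0 * x 1 ^ 2 + a₃ * x 1 ^ 3 := by
  simp [binaryCubic]

theorem combo_binaryCubic (u v a₀ a₁ a₂ a₃ b₀ b₁ b₂ b₃ : ℂ) :
    C u * binaryCubic a₀ a₁ a₂ a₃ + C v * binaryCubic b₀ b₁ b₂ b₃ =
      binaryCubic (u * a₀ + v * b₀) (u * a₁ + v * b₁) (u * a₂ + v * b₂) (u * a₃ + v * b₃) := by
  simp only [binaryCubic, C_add, C_mul]
  ring

theorem MvPolynomial.IsHomogeneous.exists_eq_binaryCubic {α : MvPolynomial (Fin 2) ℂ}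
    (h : α.IsHomogeneous 3) : ∃ a₀ a₁ a₂ a₃, α = binaryCubic a₀ a₁ a₂ a₃ := by
  let e (i j : ℕ) : Fin 2 →₀ ℕ := Finsupp.single 0 i + Finsupp.single 1 j
  have he (i j : ℕ) (a : ℂ) : C a * X 0 ^ i * X 1 ^ j = monomial (e i j) a := by
    simp [e, X_pow_eq_monomial, C_mul_monomial, monomial_mul]
  refine ⟨coeff (e 3 0) α, coeff (e 2 1) α, coeff (e 1 2) α, coeff (e 0 3) α, ?_⟩
  have hb (a₀ a₁ a₂ a₃ : ℂ) : binaryCubic a₀ a₁ a₂ a₃ = monomial (e 3 0) a₀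
      + monomial (e 2 1) a₁ + monomial (e 1 2) a₂ + monomial (e 0 3) a₃ := by
    simp only [← he, binaryCubic]
    ring
  rw [hb]
  ext m
  have hm : m = e (m 0) (m 1) := by
    ext i
    fin_cases i <;> simp [e]
  have hinj (i j k l : ℕ) : e i j = e k l ↔ i = k ∧ j = l := by
    simp [e, Finsupp.ext_iff, Fin.forall_fin_two]
  generalize m 0 = i at hm
  generalize m 1 = j at hm
  subst hm
  simp only [coeff_add, coeff_monomial, hinj]
  by_cases hd : i + j = 3
  · have hi : i ≤ 3 := by omega
    interval_cases i
    · obtain rfl : j = 3 := by omega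
      simp
    · obtain rfl : j = 2 := by omega
      simp
    · obtain rfl : j = 1 := by omega
      simp
    · obtain rfl : j = 0 := by omega
      simp
  · rw [h.coeff_eq_zero (by simpa [e, Finsupp.degree_eq_sum] using hd)]
    repeat rw [if_neg (by omega)]
    simp

theorem substA_C (A : Matrix (Fin 2) (Fin 2) ℂ) (a : ℂ) : substA A (C a) = C a :=
  (substA A).commutes a

theorem substA_X (A : Matrix (Fin 2) (Fin 2) ℂ) (i : Fin 2) :
    substA A (X i) = C (A i 0) * X 0 + C (A i 1) * X 1 := by
  simp [substA]

theorem eval_substA (A : Matrix (Fin 2) (Fin 2) ℂ) (f : MvPolynomial (Fin 2) ℂ)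
    (x : Fin 2 → ℂ) : eval x (substA A f) = eval (A.mulVec x) f := by
  induction f using MvPolynomial.induction_on with
  | C a => simp
  | add p q hp hq => simp [hp, hq]
  | mul_X p i hp =>
    rw [map_mul, map_mul, map_mul, hp, substA_X]
    congr 1
    simp only [map_add, map_mul, eval_C, eval_X, Matrix.mulVec, dotProduct, Fin.sum_univ_two]

theorem substA_substA (A A' : Matrix (Fin 2) (Fin 2) ℂ) (f : MvPolynomial (Fin 2) ℂ) :
    substA A' (substA A f) = substA (A * A') f := by
  apply MvPolynomial.funext
  intro x
  simp only [eval_substA, Matrix.mulVec_mulVec]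

/-- Swapping in a new point at infinity: the coefficient of `X 1 ^ 3` becomes the value of the
cubic at `(1, t)`, that of `X 0 * X 1 ^ 2` the derivative there. -/
theorem substA_binaryCubic_swap (t a₀ a₁ a₂ a₃ : ℂ) :
    substA !![0, 1; 1, t] (binaryCubic a₀ a₁ a₂ a₃) =
      binaryCubic a₃ (a₂ + 3 * a₃ * t) (a₁ + 2 * a₂ * t + 3 * a₃ * t ^ 2)
        (a₀ + a₁ * t + a₂ * t ^ 2 + a₃ * t ^ 3) := by
  apply MvPolynomial.funext
  intro x
  simp only [eval_substA, eval_binaryCubic, Matrix.mulVec, dotProduct, Fin.sum_univ_two]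
  simp
  ring

theorem substA_binaryCubic_shear (t a₀ a₁ a₂ a₃ : ℂ) :
    substA !![1, 0; t, 1] (binaryCubic a₀ a₁ a₂ a₃) =
      binaryCubic (a₀ + a₁ * t + a₂ * t ^ 2 + a₃ * t ^ 3)
        (a₁ + 2 * a₂ * t + 3 * a₃ * t ^ 2) (a₂ + 3 * a₃ * t) a₃ := by
  apply MvPolynomial.funext
  intro x
  simp only [eval_substA, eval_binaryCubic, Matrix.mulVec, dotProduct, Fin.sum_univ_two]
  simp
  ring

/-- `(β₁, β₂)` arises from `(α₁, α₂)` by an invertible change of basis of the pencil followed by an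
invertible linear substitution of the variables. -/
def PencilEquiv (α₁ α₂ β₁ β₂ : MvPolynomial (Fin 2) ℂ) : Prop :=
  ∃ b A : Matrix (Fin 2) (Fin 2) ℂ, IsUnit b.det ∧ IsUnit A.det ∧
    substA A (C (b 0 0) * α₁ + C (b 0 1) * α₂) = β₁ ∧
    substA A (C (b 1 0) * α₁ + C (b 1 1) * α₂) = β₂

namespace PencilEquiv

variable {α₁ α₂ β₁ β₂ γ₁ γ₂ : MvPolynomial (Fin 2) ℂ}

theorem trans (h : PencilEquiv α₁ α₂ β₁ β₂) (h' : PencilEquiv β₁ β₂ γ₁ γ₂) :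
    PencilEquiv α₁ α₂ γ₁ γ₂ := by
  obtain ⟨b, A, hb, hA, rfl, rfl⟩ := h
  obtain ⟨b', A', hb', hA', rfl, rfl⟩ := h'
  refine ⟨b' * b, A * A', Matrix.det_mul b' b ▸ hb'.mul hb, Matrix.det_mul A A' ▸ hA.mul hA', ?_, ?_⟩ <;>
  · simp only [← substA_substA, Matrix.mul_apply, Fin.sum_univ_two, map_add, map_mul, substA_C]
    ring

theorem of_basis (b : Matrix (Fin 2) (Fin 2) ℂ) (hb : b.det ≠ 0) :
    PencilEquiv α₁ α₂ (C (b 0 0) * α₁ + C (b 0 1) * α₂) (C (b 1 0) * α₁ + C (b 1 1) * α₂) := by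
  have h (f : MvPolynomial (Fin 2) ℂ) : substA 1 f = f :=
    MvPolynomial.funext fun x => by simp [eval_substA]
  exact ⟨b, 1, hb.isUnit, by simp, h _, h _⟩

theorem of_subst (A : Matrix (Fin 2) (Fin 2) ℂ) (hA : A.det ≠ 0) :
    PencilEquiv α₁ α₂ (substA A α₁) (substA A α₂) :=
  ⟨1, A, by simp, hA.isUnit, by simp, by simp⟩

theorem no_common_zero (h : PencilEquiv α₁ α₂ β₁ β₂)
    (hα : ∀ x : Fin 2 → ℂ, x ≠ 0 → ¬(eval x α₁ = 0 ∧ eval x α₂ = 0)) :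
    ∀ x : Fin 2 → ℂ, x ≠ 0 → ¬(eval x β₁ = 0 ∧ eval x β₂ = 0) := by
  obtain ⟨b, A, hb, hA, rfl, rfl⟩ := h
  rintro x hx ⟨h1, h2⟩
  refine hα (A.mulVec x) (fun h0 => hx (Matrix.eq_zero_of_mulVec_eq_zero hA.ne_zero h0)) ?_
  simp only [eval_substA, map_add, map_mul, eval_C] at h1 h2
  have key : b.mulVec ![eval (A.mulVec x) α₁, eval (A.mulVec x) α₂] = 0 := by
    ext i
    fin_cases i
    · simpa [Matrix.mulVec, dotProduct, Fin.sum_univ_two] using h1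
    · simpa [Matrix.mulVec, dotProduct, Fin.sum_univ_two] using h2
  have := Matrix.eq_zero_of_mulVec_eq_zero hb.ne_zero key
  exact ⟨congrFun this 0, congrFun this 1⟩

end PencilEquiv

/-- If the member of the pencil vanishing at `(0, 1)` vanishes there doubly, it can be taken as the
first basis element. -/
theorem pencilEquiv_of_double_zero {a₀ a₁ a₂ a₃ b₀ b₁ b₂ b₃ : ℂ} (h : a₃ ≠ 0 ∨ b₃ ≠ 0)
    (hJ : b₃ * a₂ = a₃ * b₂) : ∃ c d r q p : ℂ,
      PencilEquiv (binaryCubic a₀ a₁ a₂ a₃) (binaryCubic b₀ b₁ b₂ b₃)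
        (binaryCubic c d 0 0) (binaryCubic r q p 1) := by
  obtain ⟨u, v, huv⟩ : ∃ u v : ℂ, u * a₃ + v * b₃ = 1 := by
    rcases h with h | h
    · exact ⟨a₃⁻¹, 0, by simp [h]⟩
    · exact ⟨0, b₃⁻¹, by simp [h]⟩
  have hequiv := PencilEquiv.of_basis (α₁ := binaryCubic a₀ a₁ a₂ a₃)
    (α₂ := binaryCubic b₀ b₁ b₂ b₃) !![b₃, -a₃; u, v] (by
      rw [Matrix.det_fin_two_of, show b₃ * v - -a₃ * u = 1 by linear_combination huv]
      exact one_ne_zero)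
  simp only [Matrix.of_apply, Matrix.cons_val', Matrix.cons_val_zero, Matrix.cons_val_one,
    Matrix.cons_val_fin_one, combo_binaryCubic, huv,
    show b₃ * a₂ + -a₃ * b₂ = 0 by linear_combination hJ,
    show b₃ * a₃ + -a₃ * b₃ = 0 by ring] at hequiv
  exact ⟨_, _, _, _, _, hequiv⟩

theorem exists_pencilEquiv_double_zero {a₀ a₁ a₂ a₃ b₀ b₁ b₂ b₃ : ℂ}
    (hcz : ∀ x : Fin 2 → ℂ, x ≠ 0 → ¬(eval x (binaryCubic a₀ a₁ a₂ a₃) = 0 ∧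
      eval x (binaryCubic b₀ b₁ b₂ b₃) = 0)) : ∃ c d r q p : ℂ,
      PencilEquiv (binaryCubic a₀ a₁ a₂ a₃) (binaryCubic b₀ b₁ b₂ b₃)
        (binaryCubic c d 0 0) (binaryCubic r q p 1) := by
  by_cases hJ : b₃ * a₂ = a₃ * b₂
  · refine pencilEquiv_of_double_zero ?_ hJ
    have := hcz ![0, 1] (by simp)
    simp [eval_binaryCubic] at this
    tauto
  · obtain ⟨t, ht⟩ := exists_root_quartic (a₀ * b₁ - a₁ * b₀) (2 * (a₀ * b₂ - a₂ * b₀))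
      (3 * (a₀ * b₃ - a₃ * b₀) + (a₁ * b₂ - a₂ * b₁)) (2 * (a₁ * b₃ - a₃ * b₁))
      (a₂ * b₃ - a₃ * b₂) (Or.inr (Or.inr fun h => hJ (by linear_combination h)))
    have hequiv := PencilEquiv.of_subst (α₁ := binaryCubic a₀ a₁ a₂ a₃)
      (α₂ := binaryCubic b₀ b₁ b₂ b₃) !![0, 1; 1, t] (by simp [Matrix.det_fin_two_of])
    simp only [substA_binaryCubic_swap] at hequiv
    have hval := hcz ![1, t] (by simp)
    simp [eval_binaryCubic] at hval
    obtain ⟨c, d, r, q, p, h⟩ := pencilEquiv_of_double_zero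
      (a₀ := a₃) (a₁ := a₂ + 3 * a₃ * t) (a₂ := a₁ + 2 * a₂ * t + 3 * a₃ * t ^ 2)
      (a₃ := a₀ + a₁ * t + a₂ * t ^ 2 + a₃ * t ^ 3)
      (b₀ := b₃) (b₁ := b₂ + 3 * b₃ * t) (b₂ := b₁ + 2 * b₂ * t + 3 * b₃ * t ^ 2)
      (b₃ := b₀ + b₁ * t + b₂ * t ^ 2 + b₃ * t ^ 3) (by tauto) (by linear_combination -ht)
    exact ⟨c, d, r, q, p, hequiv.trans h⟩

theorem exists_pencilEquiv_normal_form {c d r q p : ℂ}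
    (hcz : ∀ x : Fin 2 → ℂ, x ≠ 0 → ¬(eval x (binaryCubic c d 0 0) = 0 ∧
      eval x (binaryCubic r q p 1) = 0)) : ∃ e g : ℂ,
      PencilEquiv (binaryCubic c d 0 0) (binaryCubic r q p 1)
        (binaryCubic 1 e 0 0) (binaryCubic 0 0 g 1) := by
  have hval (t : ℂ) : ¬(c + d * t = 0 ∧ r + q * t + p * t ^ 2 + t ^ 3 = 0) := by
    simpa [eval_binaryCubic] using hcz ![1, t] (by simp)
  have hcd : ¬(c = 0 ∧ d = 0) := by
    rintro ⟨rfl, rfl⟩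
    obtain ⟨t, ht⟩ := exists_root_quartic r q p 1 0 (by simp)
    exact hval t ⟨by simp, by linear_combination ht⟩
  obtain ⟨t, ht⟩ := exists_root_quartic (c * q - d * r) (2 * (c * p)) (3 * c + d * p) (2 * d) 0
    (by
      by_contra! h
      obtain rfl : d = 0 := by simpa using h.2.1
      exact hcd ⟨by simpa using h.1, rfl⟩)
  have hne : c + d * t ≠ 0 := by
    intro h0
    have hd : d ≠ 0 := by
      rintro rfl
      exact hcd ⟨by simpa using h0, rfl⟩
    refine hval t ⟨h0, (mul_eq_zero.mp ?_).resolve_left hd⟩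
    linear_combination (q + 2 * p * t + 3 * t ^ 2) * h0 - ht
  obtain ⟨s, hs⟩ : ∃ s, s * (c + d * t) = -(r + q * t + p * t ^ 2 + t ^ 3) :=
    ⟨_, div_mul_cancel₀ _ hne⟩
  have hequiv := PencilEquiv.of_subst (α₁ := binaryCubic c d 0 0)
    (α₂ := binaryCubic r q p 1) !![1, 0; t, 1] (by simp [Matrix.det_fin_two_of])
  have hbasis := PencilEquiv.of_basis (α₁ := substA !![1, 0; t, 1] (binaryCubic c d 0 0))
    (α₂ := substA !![1, 0; t, 1] (binaryCubic r q p 1))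
    !![(c + d * t)⁻¹, 0; s, 1]
    (by simpa [Matrix.det_fin_two_of] using hne)
  refine ⟨(c + d * t)⁻¹ * d, p + 3 * t, ?_⟩
  convert hequiv.trans hbasis using 1
  · simp only [substA_binaryCubic_shear, Matrix.of_apply, Matrix.cons_val', Matrix.cons_val_zero,
      Matrix.cons_val_one, Matrix.cons_val_fin_one, combo_binaryCubic]
    congr 1 <;> simp [hne]
  · simp only [substA_binaryCubic_shear, Matrix.of_apply, Matrix.cons_val', Matrix.cons_val_zero,
      Matrix.cons_val_one, Matrix.cons_val_fin_one, combo_binaryCubic]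
    congr 1
    · linear_combination -hs
    · refine mul_left_cancel₀ hne ?_
      linear_combination -d * hs - ht
    · simp
    · simp

/-- Binary cubics `α₁, α₂` with no common zero in `ℂ² ∖ {0}` can be normalized:
there are invertible matrices `(bᵢⱼ)` and `A` in `GL₂(ℂ)` and constants `e, g ∈ ℂ` with
`(b₁₁α₁ + b₁₂α₂)(A(X₁,X₂)) = X₁³ + eX₁²X₂` and
`(b₂₁α₁ + b₂₂α₂)(A(X₁,X₂)) = gX₁X₂² + X₂³`. -/
theorem binary_cubics_normal_form (α₁ α₂ : MvPolynomial (Fin 2) ℂ)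
    (h₁ : α₁.IsHomogeneous 3) (h₂ : α₂.IsHomogeneous 3)
    (hcz : ∀ x : Fin 2 → ℂ, x ≠ 0 → ¬(eval x α₁ = 0 ∧ eval x α₂ = 0)) :
    ∃ (b A : Matrix (Fin 2) (Fin 2) ℂ) (e g : ℂ),
      IsUnit b.det ∧ IsUnit A.det ∧
      substA A (C (b 0 0) * α₁ + C (b 0 1) * α₂) = X 0 ^ 3 + C e * X 0 ^ 2 * X 1 ∧
      substA A (C (b 1 0) * α₁ + C (b 1 1) * α₂) = C g * X 0 * X 1 ^ 2 + X 1 ^ 3 := by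
  obtain ⟨a₀, a₁, a₂, a₃, rfl⟩ := h₁.exists_eq_binaryCubic
  obtain ⟨b₀, b₁, b₂, b₃, rfl⟩ := h₂.exists_eq_binaryCubic
  obtain ⟨c, d, r, q, p, h⟩ := exists_pencilEquiv_double_zero hcz
  obtain ⟨e, g, h'⟩ := exists_pencilEquiv_normal_form (h.no_common_zero hcz)
  obtain ⟨b, A, hb, hA, h1, h2⟩ := h.trans h'
  refine ⟨b, A, e, g, hb, hA, ?_, ?_⟩
  · simpa [binaryCubic] using h1
  · simpa [binaryCubic] using h2
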